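/- arXiv:math/0410620 — 2 statements merged into one kernel-verified Lean document; each statement's English description precedes it below -/
import Mathlib

section
/- Let A be a ring and let σ be any set of homomorphisms between finitely generated projective left A-modules. Then a universal σ-inverting ring homomorphism exists: there are a ring B and a σ-inverting ring homomorphism θ : A → B such that every σ-inverting ring homomorphism g : A → C factors as g = h ∘ θ for a unique ring homomorphism h : B → C. -/
/-!
Statement 0: existence of the universal σ-inverting ring homomorphism (Cohn localisation).
-/

universe u v w y

open CategoryTheory Function

variable {A : Type u} [Ring A]

/-- A ring homomorphism `f : A → B` is `σ`-inverting if for every `s i : P i → Q i` in `σ`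
and every left `B`-module `M`, regarded as an `A`-module via `f`, precomposition with `s i`
induces a bijection `Hom_A(Q i, M) → Hom_A(P i, M)`; this is equivalent to the bijectivity of
`1 ⊗ s i : B ⊗_A P i → B ⊗_A Q i`, since `B ⊗_A P` represents `M ↦ Hom_A(P, M)` on
left `B`-modules. -/
def IsInverting {ι : Type v} {P Q : ι → Type w}
    [∀ i, AddCommGroup (P i)] [∀ i, Module A (P i)]
    [∀ i, AddCommGroup (Q i)] [∀ i, Module A (Q i)]
    (s : ∀ i, P i →ₗ[A] Q i)
    {B : Type y} [Ring B] (f : A →+* B) : Prop :=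
  ∀ (M : Type (max u w y)) [AddCommGroup M] [Module B M] (i : ι),
    letI : Module A M := Module.compHom M f
    Function.Bijective fun (g : Q i →ₗ[A] M) => g.comp (s i)

/-- A finite projective module has a finite dual basis. -/
theorem exists_finite_dual_basis (R : Type*) [Ring R] (M : Type*) [AddCommGroup M] [Module R M]
    [Module.Finite R M] [Module.Projective R M] :
    ∃ (n : ℕ) (x : Fin n → M) (φ : Fin n → M →ₗ[R] R), ∀ m, ∑ a, φ a m • x a = m := by
  obtain ⟨n, f, g, -, -, hfg⟩ := Module.Finite.exists_comp_eq_id_of_projective R M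
  refine ⟨n, fun a => f (Pi.single a 1), fun a => LinearMap.proj a ∘ₗ g, fun m => ?_⟩
  have h := LinearMap.congr_fun hfg m
  simp only [LinearMap.comp_apply, LinearMap.id_apply] at h
  conv_rhs => rw [← h, ← Finset.univ_sum_single (g m), map_sum]
  refine Finset.sum_congr rfl fun a _ => ?_
  rw [LinearMap.comp_apply, LinearMap.proj_apply, ← map_smul, ← Pi.single_smul]
  simp

section RestrictScalars

variable {B : Type*} [Ring B] (f : A →+* B)
  {N : Type*} [AddCommGroup N] [Module A N] {M : Type*} [AddCommGroup M] [Module B M]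

/-- Semilinear maps along `f` are linear maps into the restriction of scalars along `f`. -/
def semilinearEquivCompHom :
    letI : Module A M := Module.compHom M f
    (N →ₛₗ[f] M) ≃ (N →ₗ[A] M) :=
  letI : Module A M := Module.compHom M f
  { toFun := fun g => { toFun := g, map_add' := g.map_add, map_smul' := g.map_smulₛₗ }
    invFun := fun g => { toFun := g, map_add' := g.map_add, map_smul' := g.map_smul }
    left_inv := fun _ => rfl
    right_inv := fun _ => rfl }

end RestrictScalars

section Inverting

variable {ι : Type v} {P Q : ι → Type w}
  [∀ i, AddCommGroup (P i)] [∀ i, Module A (P i)]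
  [∀ i, AddCommGroup (Q i)] [∀ i, Module A (Q i)]
  {s : ∀ i, P i →ₗ[A] Q i}

theorem isInverting_iff_semilinear {B : Type y} [Ring B] {f : A →+* B} :
    IsInverting s f ↔ ∀ (M : Type (max u w y)) [AddCommGroup M] [Module B M] (i : ι),
      Bijective fun g : Q i →ₛₗ[f] M => (g.comp (s i) : P i →ₛₗ[f] M) := by
  refine forall_congr' fun M => forall_congr' fun _ => forall_congr' fun _ =>
    forall_congr' fun i => ?_
  let _ : Module A M := Module.compHom M f
  have h : (fun g : Q i →ₗ[A] M => g.comp (s i)) ∘ semilinearEquivCompHom f =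
      semilinearEquivCompHom f ∘ fun g : Q i →ₛₗ[f] M => (g.comp (s i) : P i →ₛₗ[f] M) := rfl
  change Bijective (fun g : Q i →ₗ[A] M => g.comp (s i)) ↔ _
  rw [← (semilinearEquivCompHom f).bijective.of_comp_iff, h,
    (semilinearEquivCompHom f).bijective.of_comp_iff']

/-- The target ring itself may serve as a test module. -/
theorem IsInverting.bijective_comp_self {B : Type y} [Ring B] {f : A →+* B}
    (hf : IsInverting s f) (i : ι) :
    Bijective fun g : Q i →ₛₗ[f] B => (g.comp (s i) : P i →ₛₗ[f] B) := by
  have h := isInverting_iff_semilinear.1 hf (ULift.{max u w} B) i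
  let e : ULift.{max u w} B ≃ₗ[B] B := ULift.moduleEquiv
  refine ⟨fun g₁ g₂ hg => ?_, fun p => ?_⟩
  · have := @h.1 (e.symm.toLinearMap.comp g₁) (e.symm.toLinearMap.comp g₂) <|
      LinearMap.ext fun x => congrArg e.symm (LinearMap.congr_fun hg x)
    exact LinearMap.ext fun x => e.symm.injective (LinearMap.congr_fun this x)
  · obtain ⟨q, hq⟩ := h.2 (e.symm.toLinearMap.comp p)
    exact ⟨e.toLinearMap.comp q, LinearMap.ext fun x =>
      congrArg e (LinearMap.congr_fun hq x)⟩

end Inverting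

namespace CohnLocalization

variable {ι : Type v} {P Q : ι → Type w}
  [∀ i, AddCommGroup (P i)] [∀ i, Module A (P i)]
  [∀ i, AddCommGroup (Q i)] [∀ i, Module A (Q i)]
  (s : ∀ i, P i →ₗ[A] Q i)

/-- Generators of the localisation: the elements of `A`, and for `q : Q i` and `φ` in the dual of
`P i` a symbol `inv i q φ` standing for the value at `q` of the extension of `φ` along `s i`. -/
inductive Gen (s : ∀ i, P i →ₗ[A] Q i) : Type (max u v w)
  | base (a : A) : Gen s
  | inv (i : ι) (q : Q i) (φ : P i →ₗ[A] A) : Gen s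

/-- The element of the free ring given by a scalar of `A`. -/
def base (a : A) : FreeRing (Gen s) := FreeRing.of (Gen.base a)

/-- The element of the free ring given by `Gen.inv`. -/
def inv (i : ι) (q : Q i) (φ : P i →ₗ[A] A) : FreeRing (Gen s) := FreeRing.of (Gen.inv i q φ)

/-- The defining relations: `base` is a ring homomorphism, `inv i` is a bimodule map, and
`inv i` provides an inverse of precomposition with `s i` on duals. -/
inductive Rel : FreeRing (Gen s) → FreeRing (Gen s) → Prop
  | base_one : Rel (base s 1) 1
  | base_add (a b : A) : Rel (base s (a + b)) (base s a + base s b)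
  | base_mul (a b : A) : Rel (base s (a * b)) (base s a * base s b)
  | inv_add_left (i : ι) (q q' : Q i) (φ : P i →ₗ[A] A) :
      Rel (inv s i (q + q') φ) (inv s i q φ + inv s i q' φ)
  | inv_smul_left (i : ι) (a : A) (q : Q i) (φ : P i →ₗ[A] A) :
      Rel (inv s i (a • q) φ) (base s a * inv s i q φ)
  | inv_add_right (i : ι) (q : Q i) (φ φ' : P i →ₗ[A] A) :
      Rel (inv s i q (φ + φ')) (inv s i q φ + inv s i q φ')
  | inv_smul_right (i : ι) (a : A) (q : Q i) (φ : P i →ₗ[A] A) :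
      Rel (inv s i q (MulOpposite.op a • φ)) (inv s i q φ * base s a)
  | inv_apply (i : ι) (p : P i) (φ : P i →ₗ[A] A) :
      Rel (inv s i (s i p) φ) (base s (φ p))
  | inv_comp (i : ι) (q : Q i) (ψ : Q i →ₗ[A] A) :
      Rel (inv s i q (ψ ∘ₗ s i)) (base s (ψ q))

/-- The Cohn localisation of `A` at `s`. -/
abbrev Loc : Type (max u v w) := RingQuot (Rel s)

/-- The canonical map to the Cohn localisation. -/
def toLoc : A →+* Loc s :=
  RingHom.mk'
    { toFun := fun a => RingQuot.mkRingHom (Rel s) (base s a)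
      map_one' := by rw [RingQuot.mkRingHom_rel Rel.base_one, map_one]
      map_mul' := fun a b => by rw [RingQuot.mkRingHom_rel (Rel.base_mul a b), map_mul] }
    fun a b => by
      change RingQuot.mkRingHom (Rel s) _ = _
      rw [RingQuot.mkRingHom_rel (Rel.base_add a b), map_add]; rfl

/-- The extension along `s i` of a functional on `P i`, with values in the localisation. -/
def extend (i : ι) : (P i →ₗ[A] A) →+ (Q i →ₛₗ[toLoc s] Loc s) :=
  AddMonoidHom.mk'
    (fun φ =>
      { toFun := fun q => RingQuot.mkRingHom (Rel s) (inv s i q φ)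
        map_add' := fun q q' => by
          rw [RingQuot.mkRingHom_rel (Rel.inv_add_left i q q' φ), map_add]
        map_smul' := fun a q => by
          rw [RingQuot.mkRingHom_rel (Rel.inv_smul_left i a q φ), map_mul]; rfl })
    fun φ φ' => LinearMap.ext fun q => by
      change RingQuot.mkRingHom (Rel s) _ = _
      rw [RingQuot.mkRingHom_rel (Rel.inv_add_right i q φ φ'), map_add]; rfl

variable {s}

theorem extend_smul {i : ι} (a : A) (φ : P i →ₗ[A] A) (q : Q i) :
    extend s i (MulOpposite.op a • φ) q = extend s i φ q * toLoc s a :=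
  (RingQuot.mkRingHom_rel (Rel.inv_smul_right i a q φ)).trans (map_mul _ _ _)

theorem extend_apply {i : ι} (φ : P i →ₗ[A] A) (p : P i) :
    extend s i φ (s i p) = toLoc s (φ p) :=
  RingQuot.mkRingHom_rel (Rel.inv_apply i p φ)

theorem extend_comp {i : ι} (ψ : Q i →ₗ[A] A) (q : Q i) :
    extend s i (ψ ∘ₗ s i) q = toLoc s (ψ q) :=
  RingQuot.mkRingHom_rel (Rel.inv_comp i q ψ)

theorem ringHom_ext {C : Type*} [Ring C] {h₁ h₂ : Loc s →+* C}
    (hbase : ∀ a, h₁ (toLoc s a) = h₂ (toLoc s a))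
    (hinv : ∀ i φ q, h₁ (extend s i φ q) = h₂ (extend s i φ q)) : h₁ = h₂ := by
  refine RingQuot.ringQuot_ext _ _ (FreeRing.hom_ext ?_)
  rintro (a | ⟨i, q, φ⟩)
  exacts [hbase a, hinv i φ q]

theorem isInverting_toLoc [∀ i, Module.Finite A (P i)] [∀ i, Module.Projective A (P i)]
    [∀ i, Module.Finite A (Q i)] [∀ i, Module.Projective A (Q i)] :
    IsInverting s (toLoc s) := by
  refine isInverting_iff_semilinear.2 fun M _ _ i => ?_
  obtain ⟨n, x, φ, hx⟩ := exists_finite_dual_basis A (P i)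
  obtain ⟨m, y, ψ, hy⟩ := exists_finite_dual_basis A (Q i)
  have expand (h : Q i →ₛₗ[toLoc s] M) (q : Q i) :
      h q = ∑ a, extend s i (φ a) q • h (s i (x a)) := by
    have hψ (b : Fin m) : ψ b ∘ₗ s i = ∑ a, MulOpposite.op (ψ b (s i (x a))) • φ a := by
      ext p
      conv_lhs => rw [← hx p]
      simp
    calc h q = ∑ b, toLoc s (ψ b q) • h (y b) := by
          conv_lhs => rw [← hy q]
          simp
      _ = ∑ b, ∑ a, extend s i (φ a) q • toLoc s (ψ b (s i (x a))) • h (y b) := by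
          refine Finset.sum_congr rfl fun b _ => ?_
          rw [← extend_comp, hψ, map_sum, LinearMap.sum_apply, Finset.sum_smul]
          simp only [extend_smul, mul_smul]
      _ = ∑ a, extend s i (φ a) q • h (s i (x a)) := by
          rw [Finset.sum_comm]
          refine Finset.sum_congr rfl fun a _ => ?_
          conv_rhs => rw [← hy (s i (x a))]
          simp [Finset.smul_sum]
  refine ⟨fun h₁ h₂ hh => LinearMap.ext fun q => ?_, fun p => ?_⟩
  · rw [expand h₁, expand h₂]
    exact Finset.sum_congr rfl fun a _ =>
      congrArg _ (LinearMap.congr_fun hh (x a))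
  · refine ⟨∑ a, (LinearMap.toSpanSingleton (Loc s) M (p (x a))).comp (extend s i (φ a)),
      LinearMap.ext fun z => ?_⟩
    conv_rhs => rw [← hx z]
    simp [extend_apply]

variable {C : Type y} [Ring C] {g : A →+* C}

theorem exists_lift (hg : IsInverting s g) : ∃ h : Loc s →+* C, h.comp (toLoc s) = g := by
  have hτ (i : ι) : ∃ τ : (P i →ₗ[A] A) → Q i →ₛₗ[g] C, ∀ φ p, τ φ (s i p) = g (φ p) := by
    choose τ hτ using fun φ : P i →ₗ[A] A =>
      (hg.bijective_comp_self i).2 (g.toSemilinearMap.comp φ)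
    exact ⟨τ, fun φ p => LinearMap.congr_fun (hτ φ) p⟩
  choose τ hτ using hτ
  have inj (i : ι) {t₁ t₂ : Q i →ₛₗ[g] C} (h : ∀ p, t₁ (s i p) = t₂ (s i p)) (q : Q i) :
      t₁ q = t₂ q :=
    LinearMap.congr_fun ((hg.bijective_comp_self i).1 (LinearMap.ext h)) q
  let val : Gen s → C
    | .base a => g a
    | .inv i q φ => τ i φ q
  have val_base (a : A) : FreeRing.lift val (base s a) = g a := FreeRing.lift_of _ _
  have val_inv (i : ι) (q : Q i) (φ : P i →ₗ[A] A) :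
      FreeRing.lift val (inv s i q φ) = τ i φ q := FreeRing.lift_of _ _
  have hrel ⦃x y : FreeRing (Gen s)⦄ (h : Rel s x y) :
      FreeRing.lift val x = FreeRing.lift val y := by
    induction h with
    | base_one => simp [val_base]
    | base_add a b => simp [val_base]
    | base_mul a b => simp [val_base]
    | inv_add_left i q q' φ => simp [val_inv]
    | inv_smul_left i a q φ => simp [val_inv, val_base]
    | inv_add_right i q φ φ' =>
      simp only [val_inv, map_add]
      exact inj i (t₂ := τ i φ + τ i φ') (fun p => by simp [hτ]) q
    | inv_smul_right i a q φ =>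
      simp only [val_inv, val_base, map_mul]
      exact inj i (t₂ := (LinearMap.toSpanSingleton C C (g a)).comp (τ i φ))
        (fun p => by simp [hτ]) q
    | inv_apply i p φ => simp [val_inv, val_base, hτ]
    | inv_comp i q ψ =>
      simp only [val_inv, val_base]
      exact inj i (t₂ := g.toSemilinearMap.comp ψ) (fun p => by simp [hτ]) q
  refine ⟨RingQuot.lift ⟨FreeRing.lift val, hrel⟩, RingHom.ext fun a => ?_⟩
  exact (RingQuot.lift_mkRingHom_apply _ _ _).trans (val_base a)

theorem lift_unique (hg : IsInverting s g) {h₁ h₂ : Loc s →+* C}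
    (e₁ : h₁.comp (toLoc s) = g) (e₂ : h₂.comp (toLoc s) = g) : h₁ = h₂ := by
  have hbase (h : Loc s →+* C) (e : h.comp (toLoc s) = g) (a : A) : h (toLoc s a) = g a :=
    RingHom.congr_fun e a
  let push (h : Loc s →+* C) (e : h.comp (toLoc s) = g) (i : ι) (φ : P i →ₗ[A] A) :
      Q i →ₛₗ[g] C :=
    { toFun := fun q => h (extend s i φ q)
      map_add' := by simp
      map_smul' := by simp [hbase h e] }
  refine ringHom_ext (fun a => by rw [hbase h₁ e₁, hbase h₂ e₂]) fun i φ q => ?_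
  refine LinearMap.congr_fun ((hg.bijective_comp_self i).1
    (a₁ := push h₁ e₁ i φ) (a₂ := push h₂ e₂ i φ) (LinearMap.ext fun p => ?_)) q
  change h₁ (extend s i φ (s i p)) = h₂ (extend s i φ (s i p))
  rw [extend_apply, hbase h₁ e₁, hbase h₂ e₂]

end CohnLocalization

/-- For any ring `A` and any set `σ` of homomorphisms between finitely generated projective left
`A`-modules, a universal `σ`-inverting ring homomorphism exists: there are a ring `B` and a
`σ`-inverting homomorphism `θ : A → B` through which every `σ`-inverting ring homomorphism
`g : A → C` factors uniquely. -/
theorem cohn_localization_exists {ι : Type v} {P Q : ι → Type w}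
    [∀ i, AddCommGroup (P i)] [∀ i, Module A (P i)]
    [∀ i, AddCommGroup (Q i)] [∀ i, Module A (Q i)]
    [∀ i, Module.Finite A (P i)] [∀ i, Module.Projective A (P i)]
    [∀ i, Module.Finite A (Q i)] [∀ i, Module.Projective A (Q i)]
    (s : ∀ i, P i →ₗ[A] Q i) :
    ∃ (B : RingCat.{max u v w}) (θ : A →+* B), IsInverting s θ ∧
      ∀ (C : RingCat.{y}) (g : A →+* C), IsInverting s g →
        ∃! h : (B : Type (max u v w)) →+* C, h.comp θ = g := by
  refine ⟨RingCat.of (CohnLocalization.Loc s), CohnLocalization.toLoc s,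
    CohnLocalization.isInverting_toLoc, fun C g hg => ?_⟩
  obtain ⟨h, hh⟩ := CohnLocalization.exists_lift hg
  exact ⟨h, hh, fun h' hh' => CohnLocalization.lift_unique hg hh' hh⟩
end

section
/- Let 𝔅 be a strictly full triangulated subcategory of D(A) which is closed under arbitrary (small) coproducts and contains A (the ring, viewed as a complex concentrated in degree 0). Then 𝔅 = D(A). Equivalently: any class of objects of D(A) which contains A, and is closed under isomorphism, shifts in both directions, mapping cones of morphisms between its objects, and arbitrary coproducts, contains every object of D(A). -/
/-!
Statement 2: any strictly full triangulated subcategory of `D(A)` (equivalently, any class of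
objects closed under isomorphism, shifts in both directions, mapping cones of morphisms between
its objects and arbitrary small coproducts) which contains `A` is all of `D(A)`.
-/

universe u

open CategoryTheory Limits Pretriangulated

variable (A : Type u) [Ring A] [HasDerivedCategory (ModuleCat.{u} A)]

/-- The ring `A`, viewed as an object of the derived category `D(A)`,
concentrated in degree `0`. -/
noncomputable def singleA : DerivedCategory (ModuleCat.{u} A) :=
  (DerivedCategory.singleFunctor _ 0).obj (ModuleCat.of A A)

lemma CategoryTheory.ShortComplex.map_homologyMap_eq_zero_iff {C D : Type*} [Category* C]
    [Category* D] [Abelian C] [Abelian D] (F : C ⥤ D) [F.PreservesZeroMorphisms]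
    [F.PreservesHomology] {S₁ S₂ : ShortComplex C} (φ : S₁ ⟶ S₂) :
    F.map (homologyMap φ) = 0 ↔ homologyMap (F.mapShortComplex.map φ) = 0 := by
  have := ShortComplex.mapHomologyIso_hom_naturality φ F
  constructor <;> intro h
  · rw [h, comp_zero] at this
    exact (cancel_mono (S₂.mapHomologyIso F).hom).1 (this.trans zero_comp.symm)
  · exact (cancel_epi (S₁.mapHomologyIso F).hom).1 (this.symm.trans
      ((congr_arg (· ≫ _) h).trans (zero_comp.trans comp_zero.symm)))

namespace HomologicalComplex

variable {C J ι : Type*} [Category* C] [Category* J] [Abelian C] (c : ComplexShape ι)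

/-- A functor to complexes, viewed as a complex of functors. -/
@[simps]
def functorToComplexToComplexOfFunctors :
    (J ⥤ HomologicalComplex C c) ⥤ HomologicalComplex (J ⥤ C) c where
  obj F :=
    { X := fun i => F ⋙ eval C c i
      d := fun i j =>
        { app := fun t => (F.obj t).d i j
          naturality := fun _ _ f => (F.map f).comm i j }
      shape := fun i j h => by
        ext t
        exact (F.obj t).shape i j h
      d_comp_d' := fun i j k _ _ => by
        ext t
        exact (F.obj t).d_comp_d i j k }
  map φ :=
    { f := fun i => Functor.whiskerRight φ (eval C c i)
      comm' := fun i j _ => by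
        ext t
        exact (φ.app t).comm i j }

variable [HasColimitsOfShape J C]

instance : (colim : (J ⥤ C) ⥤ C).Additive := Functor.additive_of_preserves_binary_products _

/-- Colimits of complexes are computed degreewise. -/
noncomputable def colimIsoMapHomologicalComplexColim :
    functorToComplexToComplexOfFunctors c ⋙ (colim : (J ⥤ C) ⥤ C).mapHomologicalComplex c ≅
      (colim : (J ⥤ HomologicalComplex C c) ⥤ _) :=
  NatIso.ofComponents (fun F => Hom.isoOfComponents
      (fun i => (preservesColimitIso (eval C c i) F).symm) (fun i j _ => by
        refine colimit.hom_ext (F := F ⋙ eval C c i) fun t => ?_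
        refine (ι_preservesColimitIso_inv_assoc (eval C c i) F t _).trans ?_
        refine ((colimit.ι F t).comm i j).trans ?_
        refine (congr_arg _ (ι_preservesColimitIso_inv (eval C c j) F t).symm).trans ?_
        exact (ι_colimMap_assoc (((functorToComplexToComplexOfFunctors c).obj F).d i j)
          t _).symm))
    (fun {F F'} φ => by
      ext i : 1
      refine colimit.hom_ext (F := F ⋙ eval C c i) fun t => ?_
      refine (ι_colimMap_assoc (Functor.whiskerRight φ (eval C c i)) t _).trans ?_
      refine (congr_arg _ (ι_preservesColimitIso_inv (eval C c i) F' t)).trans ?_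
      refine Eq.trans ?_ (ι_preservesColimitIso_inv_assoc (eval C c i) F t _).symm
      exact congr_arg (fun f => f.f i) (ι_colimMap φ t).symm)

variable [HasExactColimitsOfShape J C]

lemma quasiIso_colimMap {F F' : J ⥤ HomologicalComplex C c} (φ : F ⟶ F')
    (hφ : ∀ t, QuasiIso (φ.app t)) : QuasiIso (colimMap φ) := by
  have h : QuasiIso ((functorToComplexToComplexOfFunctors c).map φ) := by
    rw [quasiIso_iff_evaluation]
    exact hφ
  exact quasiIso_of_arrow_mk_iso
    (((colim : (J ⥤ C) ⥤ C).mapHomologicalComplex c).map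
      ((functorToComplexToComplexOfFunctors c).map φ)) _
    ((Functor.mapArrowFunctor _ _).mapIso (colimIsoMapHomologicalComplexColim c) |>.app
      (Arrow.mk φ))

lemma homologyMap_colimMap_eq_zero {F F' : J ⥤ HomologicalComplex C c} (φ : F ⟶ F') (i : ι)
    (hφ : ∀ t, homologyMap (φ.app t) i = 0) : homologyMap (colimMap φ) i = 0 := by
  have h : homologyMap ((functorToComplexToComplexOfFunctors c).map φ) i = 0 := by
    ext t
    exact (ShortComplex.map_homologyMap_eq_zero_iff ((evaluation J C).obj t)
      ((shortComplexFunctor _ c i).map ((functorToComplexToComplexOfFunctors c).map φ))).2 (hφ t)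
  have h' : homologyMap (((colim : (J ⥤ C) ⥤ C).mapHomologicalComplex c).map
      ((functorToComplexToComplexOfFunctors c).map φ)) i = 0 := by
    refine (ShortComplex.map_homologyMap_eq_zero_iff (colim : (J ⥤ C) ⥤ C)
      ((shortComplexFunctor _ c i).map ((functorToComplexToComplexOfFunctors c).map φ))).1 ?_
    refine Eq.trans ?_ ((colim : (J ⥤ C) ⥤ C).map_zero _ _)
    exact congr_arg _ h
  have := congr_arg (fun f => homologyMap f i)
    ((colimIsoMapHomologicalComplexColim c).hom.naturality φ)
  dsimp only [Functor.comp_map] at this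
  rw [homologyMap_comp, homologyMap_comp, h', zero_comp] at this
  exact (cancel_epi (homologyMap ((colimIsoMapHomologicalComplexColim c).hom.app F) i)).1
    (this.symm.trans comp_zero.symm)

end HomologicalComplex

/-- A null-homotopy on a coproduct of complexes can be defined on each summand. -/
noncomputable def Homotopy.ofSigma {C J ι : Type*} [Category* C] [Preadditive C]
    {c : ComplexShape ι} [HasColimitsOfShape (Discrete J) C] {W : J → HomologicalComplex C c}
    {Y : HomologicalComplex C c} {g : ∐ W ⟶ Y} (h : ∀ j, Homotopy (Sigma.ι W j ≫ g) 0) :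
    Homotopy g 0 :=
  letI H (i : ι) := isColimitOfPreserves (HomologicalComplex.eval C c i)
    (colimit.isColimit (Discrete.functor W))
  letI k (i j : ι) : (∐ W).X i ⟶ Y.X j := (H i).desc
    (Cocone.mk (Y.X j) (Discrete.natTrans fun t => (h t.as).hom i j))
  haveI fac (t : J) (i j : ι) : (Sigma.ι W t).f i ≫ k i j = (h t).hom i j :=
    (H i).fac (Cocone.mk (Y.X j) (Discrete.natTrans fun t => (h t.as).hom i j)) ⟨t⟩
  { hom := k
    zero := fun i j hij => (H i).hom_ext fun ⟨t⟩ =>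
      (fac t i j).trans (((h t).zero i j hij).trans comp_zero.symm)
    comm := fun i => (H i).hom_ext fun ⟨t⟩ => by
      refine ((h t).comm i).trans ?_
      simp only [HomologicalComplex.zero_f, add_zero]
      change _ = (Sigma.ι W t).f i ≫ (dNext i k + prevD i k)
      rw [Preadditive.comp_add, ← dNext_comp_left, ← prevD_comp_left]
      simp only [fac] }

namespace DerivedCategory

variable {C : Type*} [Category* C] [Abelian C] [HasDerivedCategory C]

lemma exists_quasiIso_homotopy_zero_of_Q_map_eq_zero {X Y : CochainComplex C ℤ} (f : X ⟶ Y)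
    (hf : Q.map f = 0) :
    ∃ (W : CochainComplex C ℤ) (s : W ⟶ X), QuasiIso s ∧ Nonempty (Homotopy (s ≫ f) 0) := by
  have h : Qh.map ((HomotopyCategory.quotient C _).map f) =
      Qh.map ((HomotopyCategory.quotient C _).map 0) :=
    hf.trans (Q.map_zero X Y).symm
  rw [MorphismProperty.map_eq_iff_precomp Qh (HomotopyCategory.quasiIso C _)] at h
  obtain ⟨W, s, hs, h⟩ := h
  obtain ⟨W, rfl⟩ := HomotopyCategory.quotient_obj_surjective W
  obtain ⟨s, rfl⟩ := (HomotopyCategory.quotient _ _).map_surjective s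
  rw [← isIso_Qh_map_iff] at hs
  refine ⟨W, s, (isIso_Q_map_iff_quasiIso C s).1 hs, ⟨HomotopyCategory.homotopyOfEq _ _ ?_⟩⟩
  rw [Functor.map_comp, h, ← Functor.map_comp, comp_zero]

variable {J : Type*} [HasColimitsOfShape (Discrete J) C] [HasExactColimitsOfShape (Discrete J) C]

lemma isIso_Q_map_sigmaMap {X Y : J → CochainComplex C ℤ} (s : ∀ j, X j ⟶ Y j)
    (hs : ∀ j, IsIso (Q.map (s j))) : IsIso (Q.map (Limits.Sigma.map s)) := by
  rw [isIso_Q_map_iff_quasiIso]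
  exact HomologicalComplex.quasiIso_colimMap _ _
    fun j => (isIso_Q_map_iff_quasiIso C (s j.as)).1 (hs j.as)

lemma Q_obj_sigma_hom_ext {X : J → CochainComplex C ℤ} {Y : DerivedCategory C}
    {f g : Q.obj (∐ X) ⟶ Y} (h : ∀ j, Q.map (Sigma.ι X j) ≫ f = Q.map (Sigma.ι X j) ≫ g) :
    f = g := by
  wlog hg : g = 0 generalizing f g
  · exact sub_eq_zero.1 (this (g := 0) (by simp [h]) rfl)
  subst hg
  obtain ⟨Y, ⟨e⟩⟩ : ∃ Z, Nonempty (Q.obj Z ≅ Y) := ⟨_, ⟨Q.objObjPreimageIso Y⟩⟩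
  rw [← cancel_mono e.inv, zero_comp]
  obtain ⟨Z, a, s, hs, hf⟩ := left_fac (f ≫ e.inv)
  have ha (j : J) : Q.map (Sigma.ι X j ≫ a) = 0 := by
    rw [Functor.map_comp, ← cancel_mono (inv (Q.map s)), Category.assoc, ← hf, ← Category.assoc,
      h, comp_zero, zero_comp, zero_comp]
  choose W w hw H using fun j => exists_quasiIso_homotopy_zero_of_Q_map_eq_zero _ (ha j)
  have := isIso_Q_map_sigmaMap w fun j => (isIso_Q_map_iff_quasiIso C _).2 (hw j)
  have h₀ : Q.map (Limits.Sigma.map w ≫ a) = 0 :=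
    (Q_map_eq_of_homotopy C (Homotopy.ofSigma fun j =>
      (Homotopy.ofEq (by simp [Sigma.ι_map_assoc])).trans (H j).some)).trans (Q.map_zero _ _)
  rw [hf, ← cancel_epi (Q.map (Limits.Sigma.map w)), ← Category.assoc, ← Functor.map_comp, h₀,
    zero_comp, comp_zero]

/-- The localization functor `Q` preserves coproducts. -/
noncomputable def isColimitCofanQ (X : J → CochainComplex C ℤ) :
    IsColimit (Cofan.mk (Q.obj (∐ X)) fun j => Q.map (Sigma.ι X j)) := by
  have ex (s : Cofan fun j => Q.obj (X j)) :
      ∃ f : Q.obj (∐ X) ⟶ s.pt, ∀ j, Q.map (Sigma.ι X j) ≫ f = s.inj j := by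
    choose W w hw a ha using fun j => right_fac (s.inj j ≫ (Q.objObjPreimageIso s.pt).inv)
    have := isIso_Q_map_sigmaMap w hw
    refine ⟨inv (Q.map (Limits.Sigma.map w)) ≫ Q.map (Sigma.desc a) ≫
      (Q.objObjPreimageIso s.pt).hom, fun j => ?_⟩
    have e : Q.map (Sigma.ι X j) ≫ inv (Q.map (Limits.Sigma.map w)) =
        inv (Q.map (w j)) ≫ Q.map (Sigma.ι W j) := by
      rw [IsIso.eq_inv_comp, ← Category.assoc, IsIso.comp_inv_eq, ← Functor.map_comp,
        ← Functor.map_comp, Sigma.ι_map]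
    rw [reassoc_of% e, ← Functor.map_comp_assoc, Sigma.ι_desc, ← Category.assoc, ← ha,
      Category.assoc, Iso.inv_hom_id, Category.comp_id]
  exact Cofan.IsColimit.mk _ (fun s => (ex s).choose) (fun s j => (ex s).choose_spec j)
    fun s m hm => Q_obj_sigma_hom_ext fun j => (hm j).trans ((ex s).choose_spec j).symm

end DerivedCategory

lemma CategoryTheory.ObjectProperty.trW.of_comp {D : Type*} [Category* D] [Preadditive D]
    [HasZeroObject D] [HasShift D ℤ] [∀ n : ℤ, (shiftFunctor D n).Additive] [Pretriangulated D]
    [IsTriangulated D] {P : ObjectProperty D} [P.IsTriangulated] [P.IsClosedUnderIsomorphisms]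
    {X Y Z : D} {f : X ⟶ Y} {g : Y ⟶ Z} (hg : P.trW g) (hfg : P.trW (f ≫ g)) : P.trW f := by
  obtain ⟨Z₂₃, v₂₃, w₂₃, H₂₃, mem₂₃⟩ := hg
  obtain ⟨Z₁₃, v₁₃, w₁₃, H₁₃, mem₁₃⟩ := hfg
  obtain ⟨Z₁₂, v₁₂, w₁₂, H₁₂⟩ := distinguished_cocone_triangle f
  exact ⟨_, _, _, H₁₂, P.ext_of_isTriangulatedClosed₁
    _ (Triangulated.someOctahedron rfl H₁₂ H₂₃ H₁₃).mem mem₁₃ mem₂₃⟩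

/-- The projection from a countable copower to its base is the cokernel of the difference between
the identity and the shift of the summands, and the sequence splits. -/
noncomputable def CategoryTheory.ShortComplex.sigmaNatSplitting {D : Type*} [Category* D]
    [Preadditive D] [HasCoproductsOfShape ℕ D] (X : D) :
    (ShortComplex.mk (𝟙 (∐ fun _ : ℕ => X) -
      Limits.Sigma.desc fun k => Limits.Sigma.ι (fun _ : ℕ => X) (k + 1))
      (Limits.Sigma.desc fun _ => 𝟙 X)
      (by ext; simp)).Splitting where
  r := Limits.Sigma.desc fun k => -∑ j ∈ Finset.range k, Limits.Sigma.ι (fun _ : ℕ => X) j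
  s := Limits.Sigma.ι (fun _ : ℕ => X) 0
  f_r := by
    ext k
    simp [Preadditive.sub_comp, Finset.sum_range_succ]
  s_g := by simp
  id := by
    ext k
    have := (Finset.sum_range_succ' (Limits.Sigma.ι fun _ : ℕ => X) k).symm.trans
      (Finset.sum_range_succ _ k)
    simp [Preadditive.comp_sub, Preadditive.comp_add, Preadditive.sum_comp, add_assoc, this]

namespace DerivedCategory

variable {C : Type*} [Category* C] [Abelian C] [HasDerivedCategory C]
  {P : ObjectProperty (DerivedCategory C)} [P.IsClosedUnderIsomorphisms]

lemma trW_Q_map_f_iff {S : ShortComplex (CochainComplex C ℤ)} (hS : S.ShortExact) :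
    P.trW (Q.map S.f) ↔ P (Q.obj S.X₃) :=
  P.trW_iff_of_distinguished _ (triangleOfSES_distinguished hS)

lemma trW_Q_map_sigmaMap {J : Type*} [HasColimitsOfShape (Discrete J) C]
    [HasExactColimitsOfShape (Discrete J) C]
    (hP : ∀ X : J → CochainComplex C ℤ, (∀ j, P (Q.obj (X j))) → P (Q.obj (∐ X)))
    {X Y : J → CochainComplex C ℤ} (f : ∀ j, X j ⟶ Y j) [∀ j, Mono (f j)]
    (hf : ∀ j, P.trW (Q.map (f j))) : P.trW (Q.map (Limits.Sigma.map f)) := by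
  let φ : Discrete.functor X ⟶ Discrete.functor Y := Discrete.natTrans fun j => f j.as
  have (j : Discrete J) : Mono (φ.app j) := inferInstanceAs (Mono (f j.as))
  have : Mono φ := NatTrans.mono_of_mono_app φ
  have hS : (ShortComplex.mk φ (cokernel.π φ) (by simp)).ShortExact :=
    { exact := ShortComplex.exact_cokernel φ }
  refine (trW_Q_map_f_iff (hS.map_of_exact (colim : (Discrete J ⥤ CochainComplex C ℤ) ⥤ _))).2 ?_
  have e : colimit (cokernel φ) ≅ ∐ fun j => (cokernel φ).obj ⟨j⟩ :=
    HasColimit.isoOfNatIso Discrete.natIsoFunctor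
  refine P.prop_of_iso (Q.mapIso e.symm) (hP _ fun j => ?_)
  exact (trW_Q_map_f_iff (hS.map_of_exact ((evaluation _ _).obj ⟨j⟩))).1 (hf j)

variable [P.IsTriangulated]

lemma prop_Q_obj_of_nat_sequence [HasColimitsOfShape (Discrete ℕ) C]
    [HasExactColimitsOfShape (Discrete ℕ) C]
    (hP : ∀ X : ℕ → CochainComplex C ℤ, (∀ j, P (Q.obj (X j))) → P (Q.obj (∐ X)))
    {X : ℕ → CochainComplex C ℤ} (f : ∀ k, X k ⟶ X (k + 1)) [∀ k, Mono (f k)]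
    (hf : ∀ k, P.trW (Q.map (f k))) (hf' : ∀ k n, HomologicalComplex.homologyMap (f k) n = 0) :
    P (Q.obj (X 0)) := by
  obtain ⟨p, hp₀, hp₁⟩ : ∃ p : ∀ k, X 0 ⟶ X k, p 0 = 𝟙 _ ∧ ∀ k, p (k + 1) = p k ≫ f k :=
    ⟨fun k => Nat.rec (𝟙 _) (fun k g => g ≫ f k) k, rfl, fun _ => rfl⟩
  have hp (k : ℕ) : Mono (p k) := by
    induction k with
    | zero => rw [hp₀]; infer_instance
    | succ k h => rw [hp₁]; infer_instance
  have hp' (k : ℕ) : P.trW (Q.map (p k)) := by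
    induction k with
    | zero => exact hp₀ ▸ P.trW_of_isIso _
    | succ k h => rw [hp₁, Q.map_comp]; exact P.trW.comp_mem _ _ h (hf k)
  let t : ∐ X ⟶ ∐ X := Sigma.desc fun k => f k ≫ Sigma.ι X (k + 1)
  have ht (n : ℤ) : HomologicalComplex.homologyMap t n = 0 := by
    have e : t = Limits.Sigma.map f ≫ Sigma.desc fun k => Sigma.ι X (k + 1) := by
      ext1 k
      simp [t]
    rw [e, HomologicalComplex.homologyMap_comp]
    refine (congr_arg (· ≫ _) ?_).trans zero_comp
    exact HomologicalComplex.homologyMap_colimMap_eq_zero _ _ n fun k => hf' k.as n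
  have ht' : QuasiIso (𝟙 _ - t) := ⟨fun n => by
    rw [quasiIsoAt_iff_isIso_homologyMap, HomologicalComplex.homologyMap_sub, ht, sub_zero,
      HomologicalComplex.homologyMap_id]
    infer_instance⟩
  have := (isIso_Q_map_iff_quasiIso C _).2 ht'
  have hg : P.trW (Q.map (Limits.Sigma.map p)) :=
    trW_Q_map_sigmaMap hP p hp'
  have comm : (𝟙 _ - Limits.Sigma.desc fun k => Sigma.ι (fun _ : ℕ => X 0) (k + 1)) ≫
      Limits.Sigma.map p = Limits.Sigma.map p ≫ (𝟙 _ - t) := by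
    ext1 k
    simp [t, Preadditive.comp_sub, Preadditive.sub_comp, hp₁]
  refine (trW_Q_map_f_iff (ShortComplex.sigmaNatSplitting (X 0)).shortExact).1 (hg.of_comp ?_)
  rw [← Functor.map_comp]
  refine (congr_arg _ ((congr_arg Q.map comm).trans (Q.map_comp _ _))).mpr ?_
  exact P.trW.comp_mem _ _ hg (P.trW_of_isIso _)

end DerivedCategory

namespace HomologicalComplex

variable {V ι : Type*} [Category* V] [Abelian V] [DecidableEq ι] {c : ComplexShape ι}

/-- The morphism from a single complex attached to a morphism to the cycles. -/
noncomputable def ofToCycles {K : HomologicalComplex V c} {j : ι} {M : V} (f : M ⟶ K.cycles j) :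
    (single V c j).obj M ⟶ K :=
  mkHomFromSingle (f ≫ K.iCycles j) (by simp)

lemma homologyMap_ofToCycles {K : HomologicalComplex V c} {j : ι} {M : V}
    (f : M ⟶ K.cycles j) :
    homologyMap (ofToCycles f) j = (singleObjHomologySelfIso c j M).hom ≫ f ≫ K.homologyπ j := by
  have h : cyclesMap (ofToCycles f) j = (singleObjCyclesSelfIso c j M).hom ≫ f := by
    rw [← cancel_mono (K.iCycles j), cyclesMap_i, ofToCycles, mkHomFromSingle_f, Category.assoc,
      singleObjCyclesSelfIso_hom, Category.assoc]
  rw [← cancel_epi (((single V c j).obj M).homologyπ j), homologyπ_naturality, h,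
    homologyπ_singleObjHomologySelfIso_hom_assoc, Category.assoc]

end HomologicalComplex

lemma CochainComplex.mappingCone.homologyMap_inr_eq_zero {C : Type*} [Category* C] [Abelian C]
    {K L : CochainComplex C ℤ} (φ : K ⟶ L) (n : ℤ) [Epi (HomologicalComplex.homologyMap φ n)] :
    HomologicalComplex.homologyMap (inr φ) n = 0 := by
  rw [← cancel_epi (HomologicalComplex.homologyMap φ n), ← HomologicalComplex.homologyMap_comp,
    comp_zero]
  exact ((HomologicalComplex.homotopyCofiber.inrCompHomotopy φ
    fun n => ⟨n - 1, by simp⟩).homologyMap_eq n).trans (HomologicalComplex.homologyMap_zero _ _ n)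

instance {C : Type*} [Category* C] [Abelian C] {K L : CochainComplex C ℤ} (φ : K ⟶ L) :
    Mono (CochainComplex.mappingCone.inr φ) := by
  have (n : ℤ) : Mono ((CochainComplex.mappingCone.inr φ).f n) :=
    mono_of_mono_fac (CochainComplex.mappingCone.inr_f_snd_v φ n)
  exact HomologicalComplex.mono_of_mono_f _ this

namespace DerivedCategory

variable {A} {P : ObjectProperty (DerivedCategory (ModuleCat.{u} A))}
  [P.IsTriangulated] [P.IsClosedUnderIsomorphisms]

lemma exists_epi_homologyMap
    (hA : P ((singleFunctor _ 0).obj (ModuleCat.of A A)))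
    (hP : ∀ (J : Type u) (X : J → CochainComplex (ModuleCat.{u} A) ℤ),
      (∀ j, P (Q.obj (X j))) → P (Q.obj (∐ X)))
    (X : CochainComplex (ModuleCat.{u} A) ℤ) :
    ∃ (F : CochainComplex (ModuleCat.{u} A) ℤ) (φ : F ⟶ X),
      P (Q.obj F) ∧ ∀ n, Epi (HomologicalComplex.homologyMap φ n) := by
  have hA' (n : ℤ) : P ((singleFunctor _ n).obj (ModuleCat.of A A)) :=
    P.prop_of_iso (((singleFunctors (ModuleCat.{u} A)).shiftIso (-n) n 0 (by simp)).app _)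
      (P.le_shift (-n) _ hA)
  let F (i : Σ n : ℤ, ModuleCat.of A A ⟶ X.cycles n) :=
    (HomologicalComplex.single (ModuleCat.{u} A) (.up ℤ) i.1).obj (ModuleCat.of A A)
  let φ : ∐ F ⟶ X := Limits.Sigma.desc fun i => HomologicalComplex.ofToCycles i.2
  refine ⟨∐ F, φ, hP _ F fun i => hA' i.1, fun n => ?_⟩
  rw [ModuleCat.epi_iff_surjective]
  intro x
  obtain ⟨z, rfl⟩ := (ModuleCat.epi_iff_surjective (X.homologyπ n)).1 inferInstance x
  let f : ModuleCat.of A A ⟶ X.cycles n := ModuleCat.ofHom (LinearMap.toSpanSingleton A _ z)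
  have h : f ≫ X.homologyπ n = (HomologicalComplex.singleObjHomologySelfIso _ n _).inv ≫
      HomologicalComplex.homologyMap (Limits.Sigma.ι F ⟨n, f⟩) n ≫
        HomologicalComplex.homologyMap φ n := by
    rw [← HomologicalComplex.homologyMap_comp, Limits.Sigma.ι_desc,
      HomologicalComplex.homologyMap_ofToCycles, Iso.inv_hom_id_assoc]
  refine ⟨_, (ConcreteCategory.congr_hom h (1 : A)).symm.trans ?_⟩
  exact congr_arg (X.homologyπ n) (one_smul A z)

lemma exists_mono_trW_homologyMap_eq_zero
    (hA : P ((singleFunctor _ 0).obj (ModuleCat.of A A)))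
    (hP : ∀ (J : Type u) (X : J → CochainComplex (ModuleCat.{u} A) ℤ),
      (∀ j, P (Q.obj (X j))) → P (Q.obj (∐ X)))
    (X : CochainComplex (ModuleCat.{u} A) ℤ) :
    ∃ (Y : CochainComplex (ModuleCat.{u} A) ℤ) (f : X ⟶ Y), Mono f ∧ P.trW (Q.map f) ∧
      ∀ n, HomologicalComplex.homologyMap f n = 0 := by
  obtain ⟨F, φ, hF, hφ⟩ := exists_epi_homologyMap hA hP X
  exact ⟨_, CochainComplex.mappingCone.inr φ, inferInstance,
    ObjectProperty.trW.mk' P (mappingCone_triangle_distinguished φ) hF,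
    fun n => CochainComplex.mappingCone.homologyMap_inr_eq_zero φ n⟩

theorem prop_of_prop_singleFunctor_obj_self
    (hA : P ((singleFunctor _ 0).obj (ModuleCat.of A A)))
    (hP : ∀ (J : Type u) (X : J → CochainComplex (ModuleCat.{u} A) ℤ),
      (∀ j, P (Q.obj (X j))) → P (Q.obj (∐ X)))
    (X : DerivedCategory (ModuleCat.{u} A)) : P X := by
  refine P.prop_of_iso (Q.objObjPreimageIso X) ?_
  choose E f hf₁ hf₂ hf₃ using exists_mono_trW_homologyMap_eq_zero hA hP
  obtain ⟨Z, hZ₀, hZ⟩ : ∃ Z : ℕ → CochainComplex (ModuleCat.{u} A) ℤ, Z 0 = Q.objPreimage X ∧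
      ∀ k, ∃ g : Z k ⟶ Z (k + 1), Mono g ∧ P.trW (Q.map g) ∧
        ∀ n, HomologicalComplex.homologyMap g n = 0 :=
    ⟨fun k => Nat.rec (Q.objPreimage X) (fun _ => E) k, rfl,
      fun _ => ⟨f _, hf₁ _, hf₂ _, hf₃ _⟩⟩
  choose g hg₁ hg₂ hg₃ using hZ
  rw [← hZ₀]
  refine prop_Q_obj_of_nat_sequence (fun Y hY => ?_) g hg₂ hg₃
  exact P.prop_of_iso (Q.mapIso (Limits.Sigma.whiskerEquiv Equiv.ulift fun _ => Iso.refl _))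
    (hP (ULift ℕ) (fun j => Y j.down) fun j => hY j.down)

end DerivedCategory

theorem generated_by_A
    (S : Set (DerivedCategory (ModuleCat.{u} A)))
    -- `S` contains `A`, viewed as a complex concentrated in degree `0`
    (hA : singleA A ∈ S)
    -- `S` is closed under isomorphism
    (hiso : ∀ x y : DerivedCategory (ModuleCat.{u} A), (x ≅ y) → x ∈ S → y ∈ S)
    -- `S` is closed under shifts in both directions
    (hshift : ∀ (x : DerivedCategory (ModuleCat.{u} A)) (n : ℤ), x ∈ S → x⟦n⟧ ∈ S)
    -- `S` is closed under mapping cones of morphisms between its objects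
    (hcone : ∀ T : Triangle (DerivedCategory (ModuleCat.{u} A)),
      (T ∈ distTriang (DerivedCategory (ModuleCat.{u} A))) →
      T.obj₁ ∈ S → T.obj₂ ∈ S → T.obj₃ ∈ S)
    -- `S` is closed under arbitrary (small) coproducts
    (hcoprod : ∀ (J : Type u) (t : J → DerivedCategory (ModuleCat.{u} A)) (c : Cofan t),
      (∀ j, t j ∈ S) → IsColimit c → c.pt ∈ S) :
    ∀ x : DerivedCategory (ModuleCat.{u} A), x ∈ S := by
  let P : ObjectProperty (DerivedCategory (ModuleCat.{u} A)) := fun x => x ∈ S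
  have : P.IsClosedUnderIsomorphisms := ⟨fun e hx => hiso _ _ e hx⟩
  have : P.IsStableUnderShift ℤ := ⟨fun n => ⟨fun x hx => hshift x n hx⟩⟩
  have : P.IsTriangulatedClosed₃ := .mk' hcone
  have : P.IsTriangulatedClosed₂ := .of_isTriangulatedClosed₃
  have : P.ContainsZero :=
    ⟨_, isZero_zero _, hcone _ (contractible_distinguished (singleA A)) hA hA⟩
  have : P.IsTriangulated := {}
  exact DerivedCategory.prop_of_prop_singleFunctor_obj_self (P := P) hA
    fun J X hX => hcoprod J _ _ hX (DerivedCategory.isColimitCofanQ X)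
end
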